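/- arXiv:2210.07112 — 5 statements merged into one kernel-verified Lean document; each statement's English description precedes it below -/
import Mathlib

section
/- For n ≥ 3, the q,t-Catalan measure μ_n is absolutely continuous with respect to two-dimensional Lebesgue measure on ℝ². -/
open MeasureTheory Finset Filter

noncomputable section

/-- `sc x = max (1 - |x|) 0`. -/
def sc (x : ℝ) : ℝ := max (1 - |x|) 0

/-- Extend `a : Fin k → ℝ` (thought of as coordinates `a_1, …, a_k`) to an ℕ-indexed
vector with the convention `a_0 = 0` (and value `0` beyond index `k`). -/
def cext {k : ℕ} (a : Fin k → ℝ) (i : ℕ) : ℝ :=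
  if h : 1 ≤ i ∧ i ≤ k then a ⟨i - 1, by omega⟩ else 0

/-- The area polytope `A_n ⊆ ℝ^{n-1}`. -/
def areaPoly (n : ℕ) : Set (Fin (n - 1) → ℝ) :=
  {a | ∀ i < n - 1, 0 ≤ cext a (i + 1) ∧ cext a (i + 1) ≤ cext a i + 1}

/-- The bounce polytope `B_n ⊆ ℝ^{n-1}`. -/
def bouncePoly (n : ℕ) : Set (Fin (n - 1) → ℝ) :=
  {b | ∀ i < n - 1, cext b i ≤ cext b (i + 1) ∧ cext b (i + 1) ≤ cext b i + 1}

/-- `area(a) = ∑_{i=0}^{n-1} a_i`. -/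
def area (n : ℕ) (a : Fin (n - 1) → ℝ) : ℝ := ∑ i ∈ Finset.range n, cext a i

/-- `dinv(a) = ∑_{0 ≤ i < j ≤ n-1} sc(a_i - a_j)`. -/
def dinv (n : ℕ) (a : Fin (n - 1) → ℝ) : ℝ :=
  ∑ j ∈ Finset.range n, ∑ i ∈ Finset.range j, sc (cext a i - cext a j)

/-- The `q,t`-Catalan measure `μ_n`: pushforward of Lebesgue measure restricted to `A_n`
under `a ↦ (dinv a, area a)`. -/
def qtMeasure (n : ℕ) : Measure (ℝ × ℝ) :=
  Measure.map (fun a => (dinv n a, area n a)) (volume.restrict (areaPoly n))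

/-- local slope of `sc` -/
noncomputable def qslope (y : ℝ) : ℝ :=
  if |y| < 1 then (if 0 < y then -1 else if y < 0 then 1 else 0) else 0

lemma qslope_zero : qslope 0 = 0 := by simp [qslope]

lemma qslope_neg (y : ℝ) : qslope (-y) = - qslope y := by
  unfold qslope
  rw [abs_neg]
  split_ifs <;> linarith

lemma qslope_nonneg {y : ℝ} (h : y ≤ 0) : 0 ≤ qslope y := by
  unfold qslope
  split_ifs <;> linarith

lemma qslope_nonpos {y : ℝ} (h : 0 ≤ y) : qslope y ≤ 0 := by
  unfold qslope
  split_ifs <;> linarith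

lemma qslope_eq_one {y : ℝ} (h : y < 0) (h1 : -1 < y) : qslope y = 1 := by
  unfold qslope
  rw [if_pos (abs_lt.2 ⟨h1, by linarith⟩), if_neg (by linarith), if_pos h]

lemma qslope_eq_neg_one {y : ℝ} (h : 0 < y) (h1 : y < 1) : qslope y = -1 := by
  unfold qslope
  rw [if_pos (abs_lt.2 ⟨by linarith, h1⟩), if_pos h]

lemma sc_local {y₀ : ℝ} (h0 : y₀ ≠ 0) (h1 : |y₀| ≠ 1) :
    ∀ᶠ y in nhds y₀, sc y = sc y₀ + qslope y₀ * (y - y₀) := by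
  rcases lt_or_gt_of_ne h1 with h | h
  · rcases lt_or_gt_of_ne h0 with h' | h'
    · have hh := abs_lt.1 h
      filter_upwards [Ioo_mem_nhds hh.1 h'] with y hy
      rw [qslope_eq_one h' hh.1, sc, sc, abs_of_neg h', abs_of_neg hy.2, max_eq_left, max_eq_left]
      · ring
      · linarith
      · linarith [hy.1]
    · have hh := abs_lt.1 h
      filter_upwards [Ioo_mem_nhds h' hh.2] with y hy
      rw [qslope_eq_neg_one h' hh.2, sc, sc, abs_of_pos h', abs_of_pos hy.1, max_eq_left,
        max_eq_left]
      · ring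
      · linarith
      · linarith [hy.2]
  · have hc : ∀ᶠ y in nhds y₀, 1 < |y| := continuous_abs.continuousAt.eventually_const_lt h
    filter_upwards [hc] with y hy
    have : qslope y₀ = 0 := by
      unfold qslope
      rw [if_neg (by linarith)]
    rw [this, sc, sc, max_eq_right (by linarith), max_eq_right (by linarith)]
    ring

/-- `cext` as a linear map -/
noncomputable def cextL (k i : ℕ) : (Fin k → ℝ) →ₗ[ℝ] ℝ where
  toFun a := cext a i
  map_add' a b := by unfold cext; split_ifs <;> simp
  map_smul' c a := by unfold cext; split_ifs <;> simp

lemma cextL_apply (k i : ℕ) (a : Fin k → ℝ) : cextL k i a = cext a i := rfl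

lemma cext_continuous (k i : ℕ) : Continuous (fun a : Fin k → ℝ => cext a i) :=
  (cextL k i).continuous_of_finiteDimensional

lemma cext_zero {k : ℕ} (a : Fin k → ℝ) : cext a 0 = 0 := by simp [cext]

/-- unit vectors -/
lemma exists_unit (k m : ℕ) (h1 : 1 ≤ m) (h2 : m ≤ k) :
    ∃ e : Fin k → ℝ, ∀ i, cext e i = if i = m then 1 else 0 := by
  refine ⟨fun t => if t.1 + 1 = m then 1 else 0, fun i => ?_⟩
  unfold cext
  by_cases h : 1 ≤ i ∧ i ≤ k
  · rw [dif_pos h]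
    have : i - 1 + 1 = i := by omega
    simp only [this]
  · rw [dif_neg h, if_neg (by omega)]

lemma null_preimage {k : ℕ} {E : Type*} [NormedAddCommGroup E] [NormedSpace ℝ E]
    [FiniteDimensional ℝ E] [MeasurableSpace E] [BorelSpace E] (μ : Measure E) [μ.IsAddHaarMeasure]
    (L : (Fin k → ℝ) →ₗ[ℝ] E) (hL : Function.Surjective L) (c : E) (S : Set E)
    (hS : MeasurableSet S) (h0 : μ S = 0) :
    volume {a | c + L a ∈ S} = 0 := by
  obtain ⟨r, hr, h⟩ := L.exists_map_addHaar_eq_smul_addHaar (volume : Measure (Fin k → ℝ)) μ hL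
  have hm : Measurable L := L.continuous_of_finiteDimensional.measurable
  have hT : MeasurableSet ((fun x => c + x) ⁻¹' S) := (measurable_const_add c) hS
  have h2 : (volume.map L) ((fun x => c + x) ⁻¹' S) = 0 := by
    rw [h, Measure.smul_apply, measure_preimage_add, h0, smul_zero]
  rwa [Measure.map_apply hm hT] at h2

lemma dsum_unit (x : ℕ → ℝ) (k n : ℕ) :
    (∑ j ∈ Finset.range n, ∑ i ∈ Finset.range j,
      qslope (x i - x j) * ((if i = k then (1:ℝ) else 0) - (if j = k then (1:ℝ) else 0)))
      = if k < n then ∑ i ∈ Finset.range n, qslope (x k - x i) else 0 := by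
  induction n with
  | zero => simp
  | succ n ih =>
    rw [Finset.sum_range_succ, ih]
    rcases lt_trichotomy k n with h | h | h
    · rw [if_pos h, if_pos (show k < n + 1 by omega), Finset.sum_range_succ]
      have : n ≠ k := by omega
      simp [this, h]
    · subst h
      rw [if_neg (lt_irrefl k), if_pos (show k < k + 1 by omega), Finset.sum_range_succ, sub_self, qslope_zero,
        zero_add, add_zero]
      refine Finset.sum_congr rfl fun i hi => ?_
      have : i ≠ k := by have := Finset.mem_range.1 hi; omega
      rw [if_neg this, if_pos rfl, ← neg_sub (x i), qslope_neg]
      ring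
    · rw [if_neg (show ¬ k < n by omega), if_neg (show ¬ k < n + 1 by omega), zero_add]
      refine Finset.sum_eq_zero fun i hi => ?_
      have := Finset.mem_range.1 hi
      rw [if_neg (by omega), if_neg (by omega)]
      ring

lemma grad_ne (n : ℕ) (hn : 3 ≤ n) (x : ℕ → ℝ) (x0 : x 0 = 0)
    (hpos : ∀ i, 1 ≤ i → i < n → 0 < x i)
    (hlt : ∀ i, i + 1 < n → x (i + 1) < x i + 1)
    (hne : ∀ i j, i < n → j < n → i ≠ j → x i ≠ x j) :
    ∃ k l, 1 ≤ k ∧ k < n ∧ 1 ≤ l ∧ l < n ∧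
      ∑ i ∈ Finset.range n, qslope (x k - x i) ≠ ∑ i ∈ Finset.range n, qslope (x l - x i) := by
  have hN : (Finset.Ico 1 n).Nonempty := ⟨1, by simp; omega⟩
  obtain ⟨k, hk, hkmin⟩ := Finset.exists_min_image (Finset.Ico 1 n) x hN
  obtain ⟨l, hl, hlmax⟩ := Finset.exists_max_image (Finset.Ico 1 n) x hN
  rw [Finset.mem_Ico] at hk hl
  have hmin : ∀ i, 1 ≤ i → i < n → x k ≤ x i := fun i h1 h2 => hkmin i (Finset.mem_Ico.2 ⟨h1, h2⟩)
  have hmax : ∀ i, i < n → x i ≤ x l := by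
    intro i h2
    rcases Nat.eq_zero_or_pos i with h | h
    · rw [h, x0]; exact (hpos l hl.1 hl.2).le
    · exact hlmax i (Finset.mem_Ico.2 ⟨h, h2⟩)
  refine ⟨k, l, hk.1, hk.2, hl.1, hl.2, ?_⟩
  have hx1 : x 1 < 1 := by have := hlt 0 (by omega); rw [x0] at this; simpa using this
  have A : 0 ≤ ∑ i ∈ Finset.range n, qslope (x k - x i) := by
    obtain ⟨p, hp1, hpn, hpk, hp⟩ : ∃ p, 1 ≤ p ∧ p < n ∧ p ≠ k ∧ x p < x k + 1 := by
      by_cases h : k = 1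
      · exact ⟨2, by omega, by omega, by omega, by rw [h]; exact hlt 1 (by omega)⟩
      · exact ⟨1, by omega, by omega, by omega, by linarith [hpos k hk.1 hk.2]⟩
    have hs0 : qslope (x k - x 0) = -1 := by
      rw [x0, sub_zero]
      exact qslope_eq_neg_one (hpos k hk.1 hk.2) (by linarith [hmin 1 le_rfl (by omega)])
    have hsp : qslope (x k - x p) = 1 := by
      refine qslope_eq_one ?_ (by linarith)
      have := lt_of_le_of_ne (hmin p hp1 hpn) (hne k p hk.2 hpn hpk.symm)
      linarith
    rw [← Finset.add_sum_erase _ _ (Finset.mem_range.2 (show 0 < n by omega)), hs0,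
      ← Finset.add_sum_erase _ _ (Finset.mem_erase.2
        ⟨(show p ≠ 0 by omega), Finset.mem_range.2 hpn⟩), hsp]
    have : 0 ≤ ∑ i ∈ ((Finset.range n).erase 0).erase p, qslope (x k - x i) := by
      refine Finset.sum_nonneg fun i hi => qslope_nonneg ?_
      simp only [Finset.mem_erase, Finset.mem_range] at hi
      linarith [hmin i (by omega) hi.2.2]
    linarith
  have B : ∑ i ∈ Finset.range n, qslope (x l - x i) ≤ -1 := by
    have hb := hlt (l - 1) (by omega)
    rw [show l - 1 + 1 = l by omega] at hb
    have hs : qslope (x l - x (l - 1)) = -1 := by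
      refine qslope_eq_neg_one ?_ (by linarith)
      have := lt_of_le_of_ne (hmax (l - 1) (by omega)) (hne (l - 1) l (by omega) hl.2 (by omega))
      linarith
    rw [← Finset.add_sum_erase _ _ (Finset.mem_range.2 (show l - 1 < n by omega)), hs]
    have : ∑ i ∈ (Finset.range n).erase (l - 1), qslope (x l - x i) ≤ 0 := by
      refine Finset.sum_nonpos fun i hi => qslope_nonpos ?_
      simp only [Finset.mem_erase, Finset.mem_range] at hi
      linarith [hmax i hi.2]
    linarith
  intro h
  linarith

lemma generic_ae (n : ℕ) :
    ∀ᵐ a : Fin (n - 1) → ℝ, ∀ j < n, ∀ i < j,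
      cext a i - cext a j ≠ 0 ∧ |cext a i - cext a j| ≠ 1 := by
  have key : ∀ j < n, ∀ i < j, ∀ c : ℝ, ∀ᵐ a : Fin (n - 1) → ℝ, cext a i - cext a j ≠ c := by
    intro j hj i hi c
    have hs : Function.Surjective (cextL (n - 1) i - cextL (n - 1) j) := by
      obtain ⟨e, he⟩ := exists_unit (n - 1) j (by omega) (by omega)
      intro r
      refine ⟨(-r) • e, ?_⟩
      rw [map_smul, LinearMap.sub_apply, cextL_apply, cextL_apply, he, he, if_pos rfl,
        if_neg (by omega)]
      simp
    have := null_preimage volume _ hs 0 {c} (measurableSet_singleton c) (by simp)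
    rw [ae_iff]
    convert this using 2
    ext a
    simp [cextL_apply]
  rw [ae_all_iff]; intro j
  rw [eventually_imp_distrib_left]; intro hj
  rw [ae_all_iff]; intro i
  rw [eventually_imp_distrib_left]; intro hi
  filter_upwards [key j hj i hi 0, key j hj i hi 1, key j hj i hi (-1)] with a h0 h1 h2
  refine ⟨h0, fun h => ?_⟩
  rcases (abs_eq zero_le_one).1 h with h | h
  · exact h1 h
  · exact h2 h

/-- linearised dinv -/
noncomputable def dinvL (n : ℕ) (x : Fin (n - 1) → ℝ) : (Fin (n - 1) → ℝ) →ₗ[ℝ] ℝ :=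
  ∑ j ∈ Finset.range n, ∑ i ∈ Finset.range j,
    qslope (cext x i - cext x j) • (cextL (n - 1) i - cextL (n - 1) j)

noncomputable def areaL (n : ℕ) : (Fin (n - 1) → ℝ) →ₗ[ℝ] ℝ :=
  ∑ j ∈ Finset.range n, cextL (n - 1) j

lemma areaL_apply (n : ℕ) (a) : areaL n a = area n a := by
  simp [areaL, area, LinearMap.sum_apply, cextL_apply]

lemma dinvL_apply (n : ℕ) (x a) : dinvL n x a = ∑ j ∈ Finset.range n, ∑ i ∈ Finset.range j,
    qslope (cext x i - cext x j) * (cext a i - cext a j) := by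
  simp [dinvL, LinearMap.sum_apply, cextL_apply]

lemma dinv_local (n : ℕ) (x : Fin (n - 1) → ℝ)
    (hx : ∀ j < n, ∀ i < j, cext x i - cext x j ≠ 0 ∧ |cext x i - cext x j| ≠ 1) :
    ∀ᶠ a in nhds x, dinv n a = (dinv n x - dinvL n x x) + dinvL n x a := by
  have : ∀ᶠ a in nhds x, ∀ j ∈ Finset.range n, ∀ i ∈ Finset.range j,
      sc (cext a i - cext a j) = sc (cext x i - cext x j)
        + qslope (cext x i - cext x j) * ((cext a i - cext a j) - (cext x i - cext x j)) := by
    rw [Filter.eventually_all_finset]; intro j hj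
    rw [Filter.eventually_all_finset]; intro i hi
    obtain ⟨h0, h1⟩ := hx j (Finset.mem_range.1 hj) i (Finset.mem_range.1 hi)
    have hc : Continuous (fun a : Fin (n - 1) → ℝ => cext a i - cext a j) :=
      (cext_continuous _ i).sub (cext_continuous _ j)
    exact (hc.tendsto x).eventually (sc_local h0 h1)
  filter_upwards [this] with a ha
  rw [dinvL_apply, dinvL_apply, dinv, dinv, ← Finset.sum_sub_distrib, ← Finset.sum_add_distrib]
  refine Finset.sum_congr rfl fun j hj => ?_
  rw [← Finset.sum_sub_distrib, ← Finset.sum_add_distrib]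
  refine Finset.sum_congr rfl fun i hi => ?_
  rw [ha j hj i hi]
  ring

lemma prod_surj (n : ℕ) (hn : 3 ≤ n) (x : Fin (n - 1) → ℝ) (hA : x ∈ areaPoly n)
    (hx : ∀ j < n, ∀ i < j, cext x i - cext x j ≠ 0 ∧ |cext x i - cext x j| ≠ 1) :
    Function.Surjective ((dinvL n x).prod (areaL n)) := by
  have x0 := cext_zero x
  have hne : ∀ i j, i < n → j < n → i ≠ j → cext x i ≠ cext x j := by
    intro i j hi hj hij h
    rcases lt_or_gt_of_ne hij with h' | h'
    · exact (hx j hj i h').1 (by linarith)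
    · exact (hx i hi j h').1 (by linarith)
  obtain ⟨k, l, hk1, hk, hl1, hl, hkl⟩ := grad_ne n hn (cext x) x0
    (by
      intro i h1 h2
      have h := (hA (i - 1) (by omega)).1
      rw [show i - 1 + 1 = i by omega] at h
      refine lt_of_le_of_ne h ?_
      rw [← x0]
      exact hne 0 i (by omega) h2 (by omega))
    (by
      intro i hi
      refine lt_of_le_of_ne (hA i (by omega)).2 fun h => ?_
      refine (hx (i + 1) hi i (by omega)).2 ?_
      rw [h]; simp)
    hne
  have key : ∀ m, 1 ≤ m → m < n → ∃ e : Fin (n - 1) → ℝ, areaL n e = 1 ∧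
      dinvL n x e = ∑ i ∈ Finset.range n, qslope (cext x m - cext x i) := by
    intro m h1 h2
    obtain ⟨e, he⟩ := exists_unit (n - 1) m h1 (by omega)
    refine ⟨e, ?_, ?_⟩
    · rw [areaL_apply, area]
      simp [he, h2]
    · rw [dinvL_apply]
      simp only [he]
      rw [dsum_unit, if_pos h2]
  obtain ⟨e, he1, he2⟩ := key k hk1 hk
  obtain ⟨f, hf1, hf2⟩ := key l hl1 hl
  rw [← he2, ← hf2] at hkl
  have hd : dinvL n x e - dinvL n x f ≠ 0 := sub_ne_zero.2 hkl
  rintro ⟨p, q⟩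
  refine ⟨((p - q * dinvL n x f) / (dinvL n x e - dinvL n x f)) • e
    + (q - (p - q * dinvL n x f) / (dinvL n x e - dinvL n x f)) • f, ?_⟩
  ext
  · change dinvL n x _ = p
    simp only [map_add, map_smul, smul_eq_mul]
    field_simp
    ring
  · change areaL n _ = q
    simp only [map_add, map_smul, smul_eq_mul, he1, hf1]
    ring

lemma sc_continuous : Continuous sc := by
  unfold sc
  fun_prop

/-- For `n ≥ 3`, the q,t-Catalan measure `μ_n` is absolutely continuous with respect to
two-dimensional Lebesgue measure on `ℝ²`. -/
theorem qtMeasure_absolutelyContinuous (n : ℕ) (hn : 3 ≤ n) :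
    qtMeasure n ≪ (volume : Measure (ℝ × ℝ)) := by
  refine Measure.AbsolutelyContinuous.mk fun S hS h0 => ?_
  have hcd : Continuous (dinv n) := by
    unfold dinv
    exact continuous_finsetSum _ fun j _ => continuous_finsetSum _ fun i _ =>
      sc_continuous.comp ((cext_continuous _ i).sub (cext_continuous _ j))
  have hca : Continuous (area n) := by
    unfold area
    exact continuous_finsetSum _ fun j _ => cext_continuous _ j
  have hm : Measurable (fun a => (dinv n a, area n a)) := (hcd.prodMk hca).measurable
  rw [qtMeasure, Measure.map_apply hm hS, Measure.restrict_apply (hm hS)]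
  have hg := generic_ae n
  rw [ae_iff] at hg
  set G : Set (Fin (n - 1) → ℝ) := {a | ∀ j < n, ∀ i < j,
      cext a i - cext a j ≠ 0 ∧ |cext a i - cext a j| ≠ 1} with hG
  set T := (fun a => (dinv n a, area n a)) ⁻¹' S with hT
  have main : volume ((T ∩ areaPoly n) ∩ G) = 0 := by
    refine measure_null_of_locally_null _ fun x hx => ?_
    obtain ⟨⟨-, hxA⟩, hxG⟩ := hx
    have hnull := null_preimage volume _ (prod_surj n hn x hxA hxG)
      (dinv n x - dinvL n x x, 0) S hS h0
    refine ⟨_, ?_, hnull⟩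
    filter_upwards [mem_nhdsWithin_of_mem_nhds (dinv_local n x hxG), self_mem_nhdsWithin]
      with a ha haT
    have h1 : (dinv n a, area n a) ∈ S := haT.1.1
    have ha' : dinv n a = (dinv n x - dinvL n x x) + dinvL n x a := ha
    rw [ha', ← areaL_apply] at h1
    simpa using h1
  refine measure_mono_null (t := ((T ∩ areaPoly n) ∩ G) ∪ Gᶜ) ?_ (measure_union_null main hg)
  intro a ha
  by_cases h : a ∈ G
  · exact Or.inl ⟨ha, h⟩
  · exact Or.inr h
end
end

section
/- Let n ≥ 1 and let b_0 ≤ b_1 ≤ ⋯ ≤ b_{n−1} be real numbers with 0 ≤ b_0. Define r(t) = ∫_0^t ∑_{i=0}^{n−1} 1_{[b_i, b_i+1]}(s) ds for t ≥ 0. Then for every j = 0, …, n−1 one has j − r(b_j) = j − ∑_{i=0}^{j−1} sc(b_j − b_i); that is, r(b_j) = ∑_{i=0}^{j−1} (1 − sc(b_j − b_i)) = ∑_{i=0}^{j−1} min(b_j − b_i, 1). (This is the relation between the bounce vector and the area vector of a continuous Dyck path: if r(b_j) = x_j = j − a_j for all j, then a_j = ∑_{i=0}^{j−1} sc(b_j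 − b_i).) -/
open MeasureTheory Finset

noncomputable section

theorem integral_aux (c t : ℝ) (hc : 0 ≤ c) (ht : 0 ≤ t) :
    (∫ s in (0 : ℝ)..t, Set.indicator (Set.Icc c (c + 1)) (fun _ => (1 : ℝ)) s) =
      max (min (t - c) 1) 0 := by
  rw [intervalIntegral.integral_of_le ht, ← integral_Icc_eq_integral_Ioc,
    setIntegral_indicator measurableSet_Icc, Set.Icc_inter_Icc]
  simp only [integral_const, smul_eq_mul, mul_one, measureReal_restrict_apply_univ,
    Real.volume_real_Icc]
  congr 1
  rw [sup_eq_right.mpr hc, ← min_sub_sub_right]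
  simp

/-- Let `0 ≤ b 0 ≤ b 1 ≤ ⋯ ≤ b (n-1)` and let
`r t = ∫_0^t ∑_i 1_{[b i, b i + 1]}(s) ds`. Then for every `j`,
`r (b j) = ∑_{i < j} (1 - sc (b j - b i)) = ∑_{i < j} min (b j - b i) 1`. -/
theorem bounce_param_horizontal_position (n : ℕ) (hn : 1 ≤ n) (b : Fin n → ℝ)
    (hmono : Monotone b) (h0 : 0 ≤ b ⟨0, by omega⟩) :
    ∀ j : Fin n,
      (∫ s in (0 : ℝ)..(b j),
          ∑ i : Fin n, Set.indicator (Set.Icc (b i) (b i + 1)) (fun _ => (1 : ℝ)) s) =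
        ∑ i ∈ Finset.univ.filter (· < j), (1 - sc (b j - b i)) ∧
      (∫ s in (0 : ℝ)..(b j),
          ∑ i : Fin n, Set.indicator (Set.Icc (b i) (b i + 1)) (fun _ => (1 : ℝ)) s) =
        ∑ i ∈ Finset.univ.filter (· < j), min (b j - b i) 1 := by
  intro j
  have hpos : ∀ i, 0 ≤ b i := fun i => h0.trans (hmono (Fin.mk_le_of_le_val (Nat.zero_le _)))
  have key : (∫ s in (0 : ℝ)..(b j),
          ∑ i : Fin n, Set.indicator (Set.Icc (b i) (b i + 1)) (fun _ => (1 : ℝ)) s) =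
        ∑ i ∈ Finset.univ.filter (· < j), min (b j - b i) 1 := by
    rw [intervalIntegral.integral_finset_sum]
    · rw [Finset.sum_filter]
      refine Finset.sum_congr rfl fun i _ => ?_
      rw [integral_aux _ _ (hpos i) (hpos j)]
      split_ifs with h
      · have := hmono h.le
        exact max_eq_left (le_min (by linarith) zero_le_one)
      · have := hmono (not_lt.mp h)
        exact max_eq_right ((min_le_left _ _).trans (by linarith))
    · intro i _
      rw [intervalIntegrable_iff]
      exact (integrableOn_const (by simp)).indicator measurableSet_Icc
  refine ⟨key.trans (Finset.sum_congr rfl fun i hi => ?_), key⟩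
  have := hmono (Finset.mem_filter.mp hi).2.le
  rw [sc, abs_of_nonneg (by linarith)]
  rcases le_total (b j - b i) 1 with h | h
  · rw [min_eq_left h, max_eq_left (by linarith)]; ring
  · rw [min_eq_right h, max_eq_right (by linarith)]; ring
end
end

section
/- If a ∈ A_n, then the nondecreasing rearrangement b = (b_1, …, b_{n−1}) of (a_1, …, a_{n−1}) lies in the bounce polytope B_n; that is, 0 ≤ b_1 ≤ 1 and b_i ≤ b_{i+1} ≤ b_i + 1 for all 1 ≤ i ≤ n−2. (Hence the sorted area vector of a continuous Dyck path is the bounce vector of a continuous Dyck path, so the map T sending a path to the path whose bounce vector is its sorted area vector is well defined.) -/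
open MeasureTheory Finset Filter

noncomputable section

/-- If `a ∈ A_n` and `b` is the nondecreasing rearrangement of `a`, then `b ∈ B_n`. -/
theorem sorted_area_vector_mem_bouncePoly (n : ℕ) (hn : 2 ≤ n)
    (a b : Fin (n - 1) → ℝ) (ha : a ∈ areaPoly n) (hmono : Monotone b)
    (hperm : ∃ σ : Equiv.Perm (Fin (n - 1)), b = a ∘ σ) :
    b ∈ bouncePoly n := by
  obtain ⟨σ, hσ⟩ := hperm
  have hA : ∀ i < n - 1, 0 ≤ cext a (i + 1) ∧ cext a (i + 1) ≤ cext a i + 1 := ha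
  have e : ∀ (c : Fin (n - 1) → ℝ) (k : Fin (n - 1)), cext c (k.1 + 1) = c k := by
    intro c k
    have hk := k.2
    unfold cext
    rw [dif_pos ⟨by omega, by omega⟩]
    rfl
  have z : ∀ (c : Fin (n - 1) → ℝ), cext c 0 = 0 := by
    intro c
    simp [cext]
  have hba : ∀ k, b k = a (σ k) := fun k => by rw [hσ]; rfl
  have hnn : ∀ k, 0 ≤ b k := by
    intro k
    rw [hba, ← e a (σ k)]
    exact (hA _ (σ k).2).1
  have hB0 : ∀ i ≤ n - 1, 0 ≤ cext b i := by
    intro i hi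
    rcases i with _ | i
    · rw [z]
    · rw [e b ⟨i, by omega⟩]
      exact hnn _
  have hmon : ∀ i j, i ≤ j → j ≤ n - 1 → cext b i ≤ cext b j := by
    intro i j hij hj
    rcases i with _ | i
    · rw [z]
      exact hB0 j hj
    · rcases j with _ | j
      · omega
      · rw [e b ⟨i, by omega⟩, e b ⟨j, by omega⟩]
        apply hmono
        simp only [Fin.mk_le_mk]
        omega
  intro i hi
  refine ⟨hmon _ _ (by omega) (by omega), ?_⟩
  by_contra hgap
  push Not at hgap
  have key : ∀ j, j ≤ n - 1 → cext a j ≤ cext b i := by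
    intro j
    induction j with
    | zero =>
      intro _
      rw [z]
      exact hB0 i (by omega)
    | succ j ih =>
      intro hj
      have h1 := (hA j (by omega)).2
      have h2 := ih (by omega)
      have h3 : cext a (j + 1) = cext b ((σ.symm ⟨j, by omega⟩).1 + 1) := by
        rw [e, hba, e a ⟨j, by omega⟩]
        simp
      have hk := (σ.symm ⟨j, by omega⟩).2
      rw [h3] at h1 ⊢
      apply hmon _ _ _ (by omega)
      by_contra hlt
      have := hmon (i + 1) _ (by omega) (Nat.succ_le_of_lt hk)
      simp only [Nat.succ_eq_add_one] at this
      linarith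
  have h4 : cext b (i + 1) = cext a ((σ ⟨i, hi⟩).1 + 1) := by
    rw [e, e b ⟨i, hi⟩, hba]
  have := key _ (Nat.succ_le_of_lt (σ ⟨i, hi⟩).2)
  simp only [Nat.succ_eq_add_one] at this
  linarith
end
end

section
/- Let b = (b_0, b_1, …, b_{n−1}) ∈ ℝ^n satisfy 0 = b_0 < b_1 < ⋯ < b_{n−1}, b_{i+1} ≤ b_i + 1 for all i, and b_j ≠ b_i + 1 for all 0 ≤ i < j ≤ n−1. Then the number of permutations σ of {0, 1, …, n−1} such that the permuted vector (b_{σ(0)}, b_{σ(1)}, …, b_{σ(n−1)}) satisfies b_{σ(0)} = 0 and 0 ≤ b_{σ(i+1)} ≤ b_{σ(i)} + 1 for all 0 ≤ i ≤ n−2 is exactly ∏_{j=1}^{n−1} #{i : 0 ≤ i < j and b_j − b_i < 1}. -/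
open Finset

def csIns (m i : ℕ) : List ℕ → List ℕ
  | [] => []
  | a :: l => if a = i then a :: m :: l else a :: csIns m i l

theorem csIns_append (m a : ℕ) (s t : List ℕ) (h : a ∉ s) :
    csIns m a (s ++ a :: t) = s ++ a :: m :: t := by
  induction s with
  | nil => simp [csIns]
  | cons c s ih =>
    simp only [List.mem_cons, not_or] at h
    simp [csIns, ih h.2, Ne.symm h.1]

def CsValid (R : ℕ → ℕ → Prop) (m : ℕ) (L : List ℕ) : Prop :=
  L.Nodup ∧ (∀ x, x ∈ L ↔ x < m) ∧ L.head? = some 0 ∧ L.IsChain R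

theorem csValid_iff (R : ℕ → ℕ → Prop) (m : ℕ) (s t : List ℕ) (a : ℕ) 
    (h1 : ∀ i < m, R m i) (h2 : ∀ p < m, R p m → ∀ i < m, R p i) :
    CsValid R (m+1) (s ++ a :: m :: t) ↔ CsValid R m (s ++ a :: t) ∧ R a m := by
  have hnd : (s ++ a :: m :: t).Nodup ↔ (s ++ a :: t).Nodup ∧ m ∉ s ++ a :: t := by
    have : (s ++ a :: m :: t).Perm (m :: (s ++ a :: t)) := by
      have := @List.perm_middle _ m (s ++ [a]) t
      simpa using this
    rw [this.nodup_iff, List.nodup_cons, and_comm]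
  have hh : (s ++ a :: m :: t).head? = (s ++ a :: t).head? := by
    cases s <;> simp
  unfold CsValid
  rw [hnd, hh]
  constructor
  · rintro ⟨⟨hn, hm⟩, hx, h0, hc⟩
    have hx' : ∀ x, x ∈ s ++ a :: t ↔ x < m := by
      intro x
      have := hx x
      by_cases hxm : x = m
      · subst hxm; simp only [hm, lt_irrefl]
      · have e : x ∈ s ++ a :: m :: t ↔ x ∈ s ++ a :: t := by simp [hxm]
        rw [← e, this]; omega
    have ha : a < m := (hx' a).1 (by simp)
    rw [List.isChain_append] at hc ⊢
    obtain ⟨hs, hc, hst⟩ := hc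
    rw [List.isChain_cons_cons] at hc
    refine ⟨⟨hn, hx', h0, hs, ?_, by simpa using hst⟩, hc.1⟩
    cases t with
    | nil => simp
    | cons c t =>
      have h3 := hc.2
      rw [List.isChain_cons_cons] at h3 ⊢
      exact ⟨h2 a ha hc.1 c ((hx' c).1 (by simp)), h3.2⟩
  · rintro ⟨⟨hn, hx, h0, hc⟩, hR⟩
    have ha : a < m := (hx a).1 (by simp)
    refine ⟨⟨hn, by simp [hx]⟩, ?_, h0, ?_⟩
    · intro x
      have := hx x
      simp only [List.mem_append, List.mem_cons] at this ⊢
      rw [Nat.lt_succ_iff_lt_or_eq, ← this]; tauto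
    · rw [List.isChain_append] at hc ⊢
      obtain ⟨hs, hc, hst⟩ := hc
      refine ⟨hs, ?_, by simpa using hst⟩
      rw [List.isChain_cons_cons]
      refine ⟨hR, ?_⟩
      cases t with
      | nil => simp
      | cons c t =>
        rw [List.isChain_cons_cons] at hc ⊢
        exact ⟨h1 c ((hx c).1 (by simp)), hc.2⟩

theorem csIns_erase (m i : ℕ) (L : List ℕ) (hi : i ∈ L) (hm : m ∉ L) :
    (csIns m i L).erase m = L := by
  induction L with
  | nil => simp at hi
  | cons c L ih =>
    simp only [List.mem_cons, not_or] at hi hm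
    unfold csIns
    have hc : (c == m) = false := by simpa using Ne.symm hm.1
    split_ifs with h
    · simp [List.erase_cons, hc]
    · rw [List.erase_cons, hc]
      simp [ih (hi.resolve_left (Ne.symm h)) hm.2]

theorem csIns_inj (m i j : ℕ) (L : List ℕ) (hi : i ∈ L) (hj : j ∈ L) (hm : m ∉ L)
    (h : csIns m i L = csIns m j L) : i = j := by
  induction L with
  | nil => simp at hi
  | cons c L ih =>
    simp only [List.mem_cons, not_or] at hi hj hm
    unfold csIns at h
    have key : ∀ k, k ∈ L → m :: L ≠ csIns m k L := by
      intro k hk he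
      cases L with
      | nil => simp at hk
      | cons d L =>
        unfold csIns at he
        split_ifs at he <;> simp_all
    split_ifs at h with h1 h2 h2
    · omega
    · exact absurd (List.cons.inj h).2 (key j (hj.resolve_left (Ne.symm h2)))
    · exact absurd (List.cons.inj h).2.symm (key i (hi.resolve_left (Ne.symm h1)))
    · exact ih (hi.resolve_left (Ne.symm h1)) (hj.resolve_left (Ne.symm h2)) hm.2 (List.cons.inj h).2

theorem cs_step (R : ℕ → ℕ → Prop) (m : ℕ) (hm : 1 ≤ m)
    (h1 : ∀ i < m, R m i) (h2 : ∀ p < m, R p m → ∀ i < m, R p i) :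
    Nat.card {L // CsValid R (m+1) L} =
      Nat.card {L // CsValid R m L} * Nat.card {i // i < m ∧ R i m} := by
  rw [← Nat.card_prod]
  symm
  have hv : ∀ p : {L // CsValid R m L} × {i // i < m ∧ R i m},
      CsValid R (m+1) (csIns m p.2.1 p.1.1) := by
    rintro ⟨⟨L, hL⟩, ⟨i, hi, hR⟩⟩
    obtain ⟨s, t, rfl, hs⟩ := List.append_of_mem ((hL.2.1 i).2 hi) |> fun ⟨s, t, h⟩ =>
      (⟨s, t, h, by
        intro his
        have := hL.1
        rw [h, List.nodup_append] at this
        exact this.2.2 i his i (by simp) rfl⟩ : ∃ s t, L = s ++ i :: t ∧ i ∉ s)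
    simp only
    rw [csIns_append _ _ _ _ hs, csValid_iff R m s t i h1 h2]
    exact ⟨hL, hR⟩
  refine Nat.card_eq_of_bijective (fun p => (⟨csIns m p.2.1 p.1.1, hv p⟩ : {L // CsValid R (m+1) L})) ⟨?_, ?_⟩
  · rintro ⟨⟨L, hL⟩, ⟨i, hi, hR⟩⟩ ⟨⟨L', hL'⟩, ⟨j, hj, hR'⟩⟩ h
    simp only [Subtype.mk.injEq] at h
    have hmL : m ∉ L := by simp [hL.2.1]
    have hmL' : m ∉ L' := by simp [hL'.2.1]
    have e : L = L' := by
      rw [← csIns_erase m i L ((hL.2.1 i).2 hi) hmL, h,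
        csIns_erase m j L' ((hL'.2.1 j).2 hj) hmL']
    subst e
    have := csIns_inj m i j L ((hL.2.1 i).2 hi) ((hL.2.1 j).2 hj) hmL h
    subst this
    rfl
  · rintro ⟨L, hL⟩
    obtain ⟨s, t, rfl⟩ := List.append_of_mem ((hL.2.1 m).2 (Nat.lt_succ_self m))
    rcases List.eq_nil_or_concat s with rfl | ⟨s, a, rfl⟩
    · have := hL.2.2.1
      simp at this
      omega
    · simp only [List.concat_eq_append, List.append_assoc, List.singleton_append, List.cons_append, List.nil_append] at hL ⊢
      have hv' := (csValid_iff R m s t a h1 h2).1 hL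
      have ha : a < m := (hv'.1.2.1 a).1 (by simp)
      have hs : a ∉ s := by
        intro his
        have := hv'.1.1
        rw [List.nodup_append] at this
        exact this.2.2 a his a (by simp) rfl
      refine ⟨⟨⟨_, hv'.1⟩, ⟨a, ha, hv'.2⟩⟩, ?_⟩
      simp only [Subtype.mk.injEq]
      exact csIns_append _ _ _ _ hs

theorem cs_base (R : ℕ → ℕ → Prop) : Nat.card {L // CsValid R 1 L} = 1 := by
  rw [Nat.card_eq_one_iff_exists]
  refine ⟨⟨[0], by simp [CsValid]⟩, ?_⟩
  rintro ⟨L, hn, hx, h0, -⟩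
  apply Subtype.ext
  change L = [0]
  match L, hn, hx, h0 with
  | [a], _, _, h0 => simpa using h0
  | a :: c :: L, hn, hx, _ =>
    have ha := (hx a).1 (by simp)
    have hc := (hx c).1 (by simp)
    have : a = c := by omega
    simp [this] at hn

theorem cs_count (R : ℕ → ℕ → Prop) (n : ℕ)
    (h1 : ∀ m < n, ∀ i < m, R m i) (h2 : ∀ m < n, ∀ p < m, R p m → ∀ i < m, R p i)
    (m : ℕ) (hm : 1 ≤ m) (hmn : m ≤ n) :
    Nat.card {L // CsValid R m L} = ∏ j ∈ Finset.Ico 1 m, Nat.card {i // i < j ∧ R i j} := by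
  induction m, hm using Nat.le_induction with
  | base => simp [cs_base]
  | succ m hm ih =>
    rw [cs_step R m hm (h1 m (by omega)) (h2 m (by omega)), ih (by omega),
      Finset.prod_Ico_succ_top hm]

/-- Counting the preimages of a strictly increasing bounce vector under sorting:
if `0 = b_0 < b_1 < ⋯ < b_{n-1}`, `b_{i+1} ≤ b_i + 1` for all `i`, and `b_j ≠ b_i + 1`
for all `i < j`, then the number of permutations `σ` of `{0, …, n-1}` such that
`(b_{σ(0)}, …, b_{σ(n-1)})` is the area vector of a continuous Dyck path (i.e.
`b_{σ(0)} = 0` and `0 ≤ b_{σ(i+1)} ≤ b_{σ(i)} + 1` for all `i`) equals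
`∏_{j=1}^{n-1} #{i < j : b_j - b_i < 1}`. -/
theorem card_sort_preimage (n : ℕ) (hn : 2 ≤ n) (b : Fin n → ℝ)
    (h0 : b ⟨0, by omega⟩ = 0) (hsm : StrictMono b)
    (hstep : ∀ i : ℕ, ∀ hi : i + 1 < n, b ⟨i + 1, hi⟩ ≤ b ⟨i, by omega⟩ + 1)
    (hne : ∀ i j : Fin n, i < j → b j ≠ b i + 1) :
    Nat.card {σ : Equiv.Perm (Fin n) //
        b (σ ⟨0, by omega⟩) = 0 ∧
        ∀ i : ℕ, ∀ hi : i + 1 < n,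
          0 ≤ b (σ ⟨i + 1, hi⟩) ∧ b (σ ⟨i + 1, hi⟩) ≤ b (σ ⟨i, by omega⟩) + 1} =
      ∏ j ∈ Finset.univ.filter (fun j : Fin n => j.1 ≠ 0),
        Nat.card {i : Fin n // i < j ∧ b j - b i < 1} := by
  let R : ℕ → ℕ → Prop := fun i j => ∃ (hi : i < n) (hj : j < n), b ⟨j, hj⟩ ≤ b ⟨i, hi⟩ + 1
  have hc := cs_count R n
    (fun m hm i hi => ⟨hm, hi.trans hm, by
      have : b ⟨i, hi.trans hm⟩ < b ⟨m, hm⟩ := hsm hi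
      linarith⟩)
    (fun m hm p hp hR i hi => ⟨hp.trans hm, hi.trans hm, by
      obtain ⟨_, _, hR⟩ := hR
      have : b ⟨i, hi.trans hm⟩ < b ⟨m, hm⟩ := hsm hi
      linarith⟩) n (by omega) le_rfl
  have hpos : ∀ i, 0 ≤ b i := fun i => h0 ▸ hsm.monotone (Nat.zero_le i.1 : (⟨0, by omega⟩ : Fin n) ≤ i)
  have hr : ∏ j ∈ Finset.Ico 1 n, Nat.card {i // i < j ∧ R i j} =
      ∏ j ∈ Finset.univ.filter (fun j : Fin n => j.1 ≠ 0),
        Nat.card {i : Fin n // i < j ∧ b j - b i < 1} := by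
    symm
    refine Finset.prod_bij (fun j _ => j.1) ?_ ?_ ?_ ?_
    · intro j hj
      simp at hj ⊢
      omega
    · intro a _ c _ h
      exact Fin.ext h
    · intro j hj
      simp at hj
      exact ⟨⟨j, hj.2⟩, by simp; omega, rfl⟩
    · intro j _
      refine Nat.card_congr ⟨fun i => ⟨i.1.1, i.2.1, i.1.2, j.2, ?_⟩,
        fun i => ⟨⟨i.1, i.2.1.trans j.2⟩, i.2.1, ?_⟩, fun i => rfl, fun i => rfl⟩
      · have := i.2.2
        simp only [Fin.eta]
        linarith
      · obtain ⟨i, hi, hi', hj', hR⟩ := i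
        simp only [Fin.eta] at hR ⊢
        have := lt_of_le_of_ne hR (hne ⟨i, hi'⟩ j hi)
        linarith
  rw [← hr, ← hc]
  have hval : ∀ σ : Equiv.Perm (Fin n), CsValid R n (List.ofFn (fun i => (σ i : ℕ))) ↔
      (b (σ ⟨0, by omega⟩) = 0 ∧
        ∀ i : ℕ, ∀ hi : i + 1 < n,
          0 ≤ b (σ ⟨i + 1, hi⟩) ∧ b (σ ⟨i + 1, hi⟩) ≤ b (σ ⟨i, by omega⟩) + 1) := by
    intro σ
    have e1 : (List.ofFn (fun i => (σ i : ℕ))).Nodup :=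
      List.nodup_ofFn.2 (fun a c h => σ.injective (Fin.ext h))
    have e2 : ∀ x, x ∈ (List.ofFn (fun i => (σ i : ℕ))) ↔ x < n := by
      intro x
      rw [List.mem_ofFn]
      constructor
      · rintro ⟨i, rfl⟩
        exact (σ i).2
      · intro hx
        exact ⟨σ.symm ⟨x, hx⟩, by simp⟩
    have e3 : (List.ofFn (fun i => (σ i : ℕ))).head? = some 0 ↔ b (σ ⟨0, by omega⟩) = 0 := by
      rw [List.head?_eq_getElem?, List.getElem?_eq_getElem (by simp; omega)]
      simp only [List.getElem_ofFn, Option.some.injEq]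
      rw [← h0, hsm.injective.eq_iff, Fin.ext_iff]
    unfold CsValid
    rw [e3, List.isChain_iff_getElem]
    constructor
    · rintro ⟨-, -, h, h'⟩
      refine ⟨h, fun i hi => ⟨hpos _, ?_⟩⟩
      obtain ⟨_, _, h''⟩ := h' i (by simpa using hi)
      simpa using h''
    · rintro ⟨h, h'⟩
      refine ⟨e1, e2, h, fun i hi => ?_⟩
      simp only [List.length_ofFn] at hi
      simp only [List.getElem_ofFn]
      exact ⟨(σ _).2, (σ _).2, (h' i hi).2⟩
  refine Nat.card_eq_of_bijective (fun σ => ⟨List.ofFn (fun i => (σ.1 i : ℕ)), (hval σ.1).2 σ.2⟩) ⟨?_, ?_⟩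
  · intro σ τ h
    simp only [Subtype.mk.injEq] at h
    have := List.ofFn_injective h
    apply Subtype.ext
    ext i
    exact congrFun this i
  · rintro ⟨L, hL⟩
    have hlen : L.length = n := by
      rw [← List.toFinset_card_of_nodup hL.1]
      have : L.toFinset = Finset.range n := by
        ext x; simp [hL.2.1]
      simp [this]
    subst hlen
    let f : Fin L.length → Fin L.length := fun i => ⟨L[i.1], (hL.2.1 _).1 (List.getElem_mem _)⟩
    have hf : Function.Injective f := by
      intro i j h
      have h' : L[i.1] = L[j.1] := congrArg Fin.val h
      exact Fin.ext ((hL.1.getElem_inj_iff).1 h')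
    let σ : Equiv.Perm (Fin L.length) := Equiv.ofBijective f (Finite.injective_iff_bijective.1 hf)
    have hσ : List.ofFn (fun i => (σ i : ℕ)) = L := by
      have : (fun i => (σ i : ℕ)) = fun i : Fin L.length => L[i.1] := rfl
      rw [this]
      exact List.ofFn_getElem
    refine ⟨⟨σ, (hval σ).1 (by rw [hσ]; exact hL)⟩, ?_⟩
    simp only [Subtype.mk.injEq]
    exact hσ
end

section
/- Let m ≥ 1 and let a ∈ A_n be such that m·a_i ∈ ℤ for all i (so that m·a = (m·a_0, …, m·a_{n−1}) is the area vector of an m-Dyck path of height n). Then |dinv(a) − (1/m)·dinv_m(m·a)| ≤ (1/m)·(n choose 2). In particular, the normalized m-dinv statistics converge uniformly to the continuous dinv statistic as m → ∞ over all 1/m-integral continuous Dyck paths. -/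
open MeasureTheory Finset Filter

noncomputable section

/-- `sc_m : ℤ → ℤ`. -/
def scm (m : ℕ) (p : ℤ) : ℤ :=
  if 1 ≤ p ∧ p ≤ (m : ℤ) then (m : ℤ) + 1 - p
  else if -(m : ℤ) ≤ p ∧ p ≤ 0 then (m : ℤ) + p
  else 0

/-- `dinv_m(a) = ∑_{0 ≤ i < j ≤ n-1} sc_m(a_i - a_j)` for `a ∈ ℤ^n`. -/
def dinvm (n m : ℕ) (a : Fin n → ℤ) : ℤ :=
  ∑ j : Fin n, ∑ i ∈ Finset.univ.filter (· < j), scm m (a i - a j)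

/-- `area_m(a) = ∑_{i=0}^{n-1} a_i` for `a ∈ ℤ^n`. -/
def aream (n : ℕ) (a : Fin n → ℤ) : ℤ := ∑ i, a i

theorem aux_pt (m : ℕ) (hm : 1 ≤ m) (x : ℝ) (p : ℤ) (hp : (p : ℝ) = m * x) :
    |sc x - (scm m p : ℝ) / m| ≤ 1 / m := by
  have hm0 : (0 : ℝ) < m := by exact_mod_cast hm
  have hx : x = p / m := by field_simp; linarith
  have key : |max ((m : ℤ) - |p|) 0 - scm m p| ≤ 1 := by
    unfold scm
    rcases abs_cases p with h | h <;> rcases max_cases ((m : ℤ) - |p|) 0 with h' | h' <;>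
    split_ifs <;> rw [abs_le] <;> omega
  have key' : |max ((m : ℝ) - |(p : ℝ)|) 0 - scm m p| ≤ 1 := by exact_mod_cast key
  have h1 : sc x = max ((m : ℝ) - |(p : ℝ)|) 0 / m := by
    unfold sc
    rw [hx, abs_div, abs_of_pos hm0]
    rw [← max_div_div_right hm0.le, sub_div, div_self hm0.ne', zero_div]
  rw [h1, ← sub_div, abs_div, abs_of_pos hm0]
  gcongr

theorem aux_sum (n : ℕ) (j : Fin n) (f : ℕ → ℝ) :
    ∑ i ∈ Finset.univ.filter (fun i : Fin n => i < j), f i.1 = ∑ i ∈ Finset.range j.1, f i := by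
  rw [Finset.sum_filter]
  have := Fin.sum_univ_eq_sum_range (fun i => if i < j.1 then f i else 0) n
  simp only [Fin.lt_def]
  rw [this, ← Finset.sum_filter]
  congr 1
  ext i
  have := j.2
  simp
  omega

/-- Uniform convergence of normalized m-dinv to continuous dinv on 1/m-integral paths:
if `a ∈ A_n` and `c ∈ ℤ^n` satisfies `c_i = m·a_i` for all `i` (with `a_0 = 0`), then
`|dinv(a) - dinv_m(m·a)/m| ≤ (1/m)·(n choose 2)`. -/
theorem dinv_approx (n : ℕ) (hn : 2 ≤ n) (m : ℕ) (hm : 1 ≤ m)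
    (a : Fin (n - 1) → ℝ) (ha : a ∈ areaPoly n)
    (c : Fin n → ℤ) (hc : ∀ i : Fin n, (c i : ℝ) = m * cext a i.1) :
    |dinv n a - (dinvm n m c : ℝ) / m| ≤ (1 / m) * (n.choose 2) := by
  have e : dinv n a = ∑ j : Fin n, ∑ i ∈ Finset.univ.filter (fun i : Fin n => i < j),
      sc (cext a i.1 - cext a j.1) := by
    unfold dinv
    rw [← Fin.sum_univ_eq_sum_range
      (fun j => ∑ i ∈ Finset.range j, sc (cext a i - cext a j)) n]
    exact Finset.sum_congr rfl fun j _ =>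
      (aux_sum n j (fun i => sc (cext a i - cext a j.1))).symm
  have e2 : ((n.choose 2 : ℕ) : ℝ) =
      ∑ j : Fin n, ∑ i ∈ Finset.univ.filter (fun i : Fin n => i < j), (1 : ℝ) := by
    rw [Finset.sum_congr rfl fun j _ => aux_sum n j (fun _ => 1)]
    rw [Fin.sum_univ_eq_sum_range (fun j => ∑ i ∈ Finset.range j, (1 : ℝ)) n]
    simp only [Finset.sum_const, Finset.card_range, nsmul_eq_mul, mul_one]
    rw [← Nat.cast_sum, Finset.sum_range_id, Nat.choose_two_right]
  rw [e, e2, dinvm]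
  push_cast
  rw [Finset.sum_div, ← Finset.sum_sub_distrib, Finset.mul_sum]
  refine (Finset.abs_sum_le_sum_abs _ _).trans (Finset.sum_le_sum fun j _ => ?_)
  rw [Finset.sum_div, ← Finset.sum_sub_distrib, Finset.mul_sum]
  refine (Finset.abs_sum_le_sum_abs _ _).trans (Finset.sum_le_sum fun i _ => ?_)
  rw [mul_one]
  apply aux_pt m hm
  push_cast
  rw [hc, hc]
  ring
end
end
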